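/- Let A be a weak Hopf algebra over a field K and l ∈ A. The following are equivalent: (a) l is a left integral, i.e. x l = Π^L(x) l for all x ∈ A; (b) Σ l₍₁₎ ⊗ x l₍₂₎ = Σ S(x) l₍₁₎ ⊗ l₍₂₎ in A ⊗ A for all x ∈ A; (c) y l = 0 for every y in the kernel of Π^L; (d) S(l) is a right integral, i.e. S(l) x = S(l) Π^R(x) for all x ∈ A. -/

import Mathlib

open TensorProduct

noncomputable section

variable (K : Type*) [Field K] (A : Type*) [Ring A] [Algebra K A]

/-- `Π^L(x) = Σ ε(1₍₁₎ x) 1₍₂₎`. -/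
def piL (Δ : A →ₗ[K] A ⊗[K] A) (ε : A →ₗ[K] K) : A →ₗ[K] A :=
  (TensorProduct.lid K A).toLinearMap ∘ₗ ε.rTensor A ∘ₗ
    LinearMap.mulLeft K (Δ 1) ∘ₗ (TensorProduct.mk K A A).flip 1

/-- `Π^R(x) = Σ 1₍₁₎ ε(x 1₍₂₎)`. -/
def piR (Δ : A →ₗ[K] A ⊗[K] A) (ε : A →ₗ[K] K) : A →ₗ[K] A :=
  (TensorProduct.rid K A).toLinearMap ∘ₗ ε.lTensor A ∘ₗ
    LinearMap.mulRight K (Δ 1) ∘ₗ TensorProduct.mk K A A 1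

/-- A weak bialgebra structure on the `K`-algebra `A`, with comultiplication `Δ`
and counit `ε`. -/
structure WeakBialgebra (Δ : A →ₗ[K] A ⊗[K] A) (ε : A →ₗ[K] K) : Prop where
  coassoc : ∀ x : A,
    (TensorProduct.assoc K A A A) (Δ.rTensor A (Δ x)) = Δ.lTensor A (Δ x)
  counit_left : ∀ x : A, (TensorProduct.lid K A) (ε.rTensor A (Δ x)) = x
  counit_right : ∀ x : A, (TensorProduct.rid K A) (ε.lTensor A (Δ x)) = x
  comul_mul : ∀ x y : A, Δ (x * y) = Δ x * Δ y
  weak_counit_a : ∀ x y z : A,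
    ε (x * y * z) =
      LinearMap.mul' K K (TensorProduct.map (ε ∘ₗ LinearMap.mulLeft K x)
        (ε ∘ₗ LinearMap.mulRight K z) (Δ y))
  weak_counit_b : ∀ x y z : A,
    ε (x * y * z) =
      LinearMap.mul' K K (TensorProduct.map (ε ∘ₗ LinearMap.mulRight K z)
        (ε ∘ₗ LinearMap.mulLeft K x) (Δ y))
  weak_comul_unit_a :
    Δ.rTensor A (Δ 1) =
      (Δ 1 ⊗ₜ[K] (1 : A)) * ((TensorProduct.assoc K A A A).symm ((1 : A) ⊗ₜ[K] Δ 1))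
  weak_comul_unit_b :
    Δ.rTensor A (Δ 1) =
      ((TensorProduct.assoc K A A A).symm ((1 : A) ⊗ₜ[K] Δ 1)) * (Δ 1 ⊗ₜ[K] (1 : A))

/-- A weak Hopf algebra structure: a weak bialgebra together with an antipode `S`. -/
structure WeakHopfAlgebra (Δ : A →ₗ[K] A ⊗[K] A) (ε : A →ₗ[K] K) (S : A →ₗ[K] A) : Prop where
  toWeakBialgebra : WeakBialgebra K A Δ ε
  antipode_a : ∀ x : A,
    LinearMap.mul' K A (LinearMap.lTensor A S (Δ x)) = piL K A Δ ε x
  antipode_b : ∀ x : A,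
    LinearMap.mul' K A (LinearMap.rTensor A S (Δ x)) = piR K A Δ ε x
  antipode_c : ∀ x : A,
    LinearMap.mul' K A (TensorProduct.map S (LinearMap.mul' K A ∘ₗ LinearMap.lTensor A S)
      (LinearMap.lTensor A Δ (Δ x))) = S x

section

open Coalgebra LinearMap

section Convolution

variable {k C B D : Type*} [CommRing k] [AddCommGroup C] [Module k C] [Coalgebra k C]
  [Ring B] [Algebra k B] [Ring D] [Algebra k D]

/-- The convolution product `(f * g)(x) = Σ f(x₍₁₎) g(x₍₂₎)`. -/
def conv (f g : C →ₗ[k] B) : C →ₗ[k] B :=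
  LinearMap.mul' k B ∘ₗ TensorProduct.map f g ∘ₗ comul

theorem conv_apply (f g : C →ₗ[k] B) {ι : Type*} {x : C} (r : Repr k x ι) :
    conv f g x = ∑ i ∈ r.index, f (r.left i) * g (r.right i) := by
  simp [conv, ← r.eq]

theorem conv_assoc (f g h : C →ₗ[k] B) : conv (conv f g) h = conv f (conv g h) :=
  congrArg WithConv.ofConv
    (mul_assoc (WithConv.toConv f) (WithConv.toConv g) (WithConv.toConv h))

theorem conv_mulLeft_comp (b : B) (f g : C →ₗ[k] B) :
    conv (mulLeft k b ∘ₗ f) g = mulLeft k b ∘ₗ conv f g := by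
  ext x
  simp [conv_apply _ _ (ℛ k x), mul_assoc]

theorem conv_mulRight_comp (b : B) (f g : C →ₗ[k] B) :
    conv f (mulRight k b ∘ₗ g) = mulRight k b ∘ₗ conv f g := by
  ext x
  simp [conv_apply _ _ (ℛ k x), mul_assoc]

theorem algHom_comp_conv (φ : B →ₐ[k] D) (f g : C →ₗ[k] B) :
    φ.toLinearMap ∘ₗ conv f g = conv (φ.toLinearMap ∘ₗ f) (φ.toLinearMap ∘ₗ g) := by
  ext x
  simp [conv_apply _ _ (ℛ k x)]

end Convolution

namespace WeakBialgebra

variable {K A} [Coalgebra K A]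

theorem piL_eq_sum {ι : Type*} (r : Repr K (1 : A) ι) (x : A) :
    piL K A comul counit x =
      ∑ i ∈ r.index, counit (R := K) (r.left i * x) • r.right i := by
  simp [piL, ← r.eq, Finset.sum_mul]

theorem piR_eq_sum {ι : Type*} (r : Repr K (1 : A) ι) (x : A) :
    piR K A comul counit x =
      ∑ i ∈ r.index, counit (R := K) (x * r.right i) • r.left i := by
  simp [piR, ← r.eq, Finset.mul_sum]

variable (h : WeakBialgebra K A comul counit)

include h

theorem comul_one_mul (x : A) : comul (R := K) (1 : A) * comul x = comul x := by
  rw [← h.comul_mul, one_mul]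

theorem comul_mul_one (x : A) : comul (R := K) x * comul (1 : A) = comul x := by
  rw [← h.comul_mul, mul_one]

theorem counit_mul_a {ι : Type*} (r : Repr K (1 : A) ι) (x z : A) :
    counit (R := K) (x * z) =
      ∑ i ∈ r.index, counit (R := K) (x * r.left i) * counit (R := K) (r.right i * z) := by
  simpa [← r.eq] using h.weak_counit_a x 1 z

theorem counit_mul_b {ι : Type*} (r : Repr K (1 : A) ι) (x z : A) :
    counit (R := K) (x * z) =
      ∑ i ∈ r.index, counit (R := K) (r.left i * z) * counit (R := K) (x * r.right i) := by
  simpa [← r.eq] using h.weak_counit_b x 1 z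

theorem counit_mul_piL (x y : A) :
    counit (R := K) (x * piL K A comul counit y) = counit (R := K) (x * y) := by
  simp [piL_eq_sum (ℛ K (1 : A)), h.counit_mul_b (ℛ K (1 : A)) x y, Finset.mul_sum]

theorem counit_piR_mul (x y : A) :
    counit (R := K) (piR K A comul counit x * y) = counit (R := K) (x * y) := by
  simp [piR_eq_sum (ℛ K (1 : A)), h.counit_mul_b (ℛ K (1 : A)) x y, Finset.sum_mul, mul_comm]

theorem piL_mul_piL (x y : A) :
    piL K A comul counit (x * piL K A comul counit y) = piL K A comul counit (x * y) := by
  simp only [piL_eq_sum (ℛ K (1 : A)) (x * _), ← mul_assoc, h.counit_mul_piL]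

theorem piR_piR_mul (x y : A) :
    piR K A comul counit (piR K A comul counit x * y) = piR K A comul counit (x * y) := by
  simp only [piR_eq_sum (ℛ K (1 : A)) (_ * y), mul_assoc, h.counit_piR_mul]

theorem piL_piL (x : A) :
    piL K A comul counit (piL K A comul counit x) = piL K A comul counit x := by
  simpa using h.piL_mul_piL 1 x

theorem piR_piR (x : A) :
    piR K A comul counit (piR K A comul counit x) = piR K A comul counit x := by
  simpa using h.piR_piR_mul x 1

/-- `Δ²(1) = (Δ(1) ⊗ 1)(1 ⊗ Δ(1))`, in coordinates. -/
theorem rTensor_comul_one_a {ι : Type*} (r : Repr K (1 : A) ι) :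
    comul.rTensor A (comul (R := K) (1 : A)) =
      ∑ i ∈ r.index, ∑ j ∈ r.index,
        (r.left i ⊗ₜ (r.right i * r.left j)) ⊗ₜ[K] r.right j := by
  rw [h.weak_comul_unit_a]
  simp [← r.eq, sum_tmul, tmul_sum, Finset.sum_mul_sum]

/-- `Δ²(1) = (1 ⊗ Δ(1))(Δ(1) ⊗ 1)`, in coordinates. -/
theorem rTensor_comul_one_b {ι : Type*} (r : Repr K (1 : A) ι) :
    comul.rTensor A (comul (R := K) (1 : A)) =
      ∑ i ∈ r.index, ∑ j ∈ r.index,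
        (r.left i ⊗ₜ (r.left j * r.right i)) ⊗ₜ[K] r.right j := by
  rw [h.weak_comul_unit_b, Finset.sum_comm]
  simp [← r.eq, sum_tmul, tmul_sum, Finset.sum_mul_sum]

/-- `Δ(Π^L(x)) = (Π^L(x) ⊗ 1) Δ(1)`. -/
theorem comul_piL (x : A) : comul (R := K) (piL K A comul counit x) =
    (piL K A comul counit x ⊗ₜ[K] 1) * comul (1 : A) := by
  let r := ℛ K (1 : A)
  let Φ : (A ⊗[K] A) ⊗[K] A →ₗ[K] A ⊗[K] A :=
    (TensorProduct.lid K _).toLinearMap ∘ₗ (counit ∘ₗ mulRight K x).rTensor _ ∘ₗ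
      (TensorProduct.assoc K A A A).toLinearMap
  have h1 := congrArg Φ (h.rTensor_comul_one_a r)
  rw [← (TensorProduct.assoc K A A A).symm_apply_apply (rTensor A comul _), h.coassoc,
    ← r.eq] at h1
  simp [Φ, -assoc_symm_tmul] at h1
  simp [piL_eq_sum r, h1, ← r.eq, Finset.sum_mul_sum, sum_tmul, smul_tmul']

/-- `Δ(Π^L(x)) = Δ(1) (Π^L(x) ⊗ 1)`. -/
theorem comul_piL' (x : A) : comul (R := K) (piL K A comul counit x) =
    comul (1 : A) * (piL K A comul counit x ⊗ₜ[K] 1) := by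
  let r := ℛ K (1 : A)
  let Φ : (A ⊗[K] A) ⊗[K] A →ₗ[K] A ⊗[K] A :=
    (TensorProduct.lid K _).toLinearMap ∘ₗ (counit ∘ₗ mulRight K x).rTensor _ ∘ₗ
      (TensorProduct.assoc K A A A).toLinearMap
  have h1 := congrArg Φ (h.rTensor_comul_one_b r)
  rw [← (TensorProduct.assoc K A A A).symm_apply_apply (rTensor A comul _), h.coassoc,
    ← r.eq] at h1
  simp [Φ, -assoc_symm_tmul] at h1
  rw [Finset.sum_comm] at h1
  simp [piL_eq_sum r, h1, ← r.eq, Finset.sum_mul_sum, sum_tmul, smul_tmul']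

/-- `Δ(Π^R(x)) = Δ(1) (1 ⊗ Π^R(x))`. -/
theorem comul_piR (x : A) : comul (R := K) (piR K A comul counit x) =
    comul (1 : A) * (1 ⊗ₜ[K] piR K A comul counit x) := by
  let r := ℛ K (1 : A)
  let Φ : (A ⊗[K] A) ⊗[K] A →ₗ[K] A ⊗[K] A :=
    (TensorProduct.rid K _).toLinearMap ∘ₗ (counit ∘ₗ mulLeft K x).lTensor _
  have h1 := congrArg Φ (h.rTensor_comul_one_a r)
  rw [← r.eq] at h1
  simp [Φ] at h1
  simp [piR_eq_sum r, h1, ← r.eq, Finset.sum_mul_sum, tmul_sum]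

/-- `Δ(Π^R(x)) = (1 ⊗ Π^R(x)) Δ(1)`. -/
theorem comul_piR' (x : A) : comul (R := K) (piR K A comul counit x) =
    (1 ⊗ₜ[K] piR K A comul counit x) * comul (1 : A) := by
  let r := ℛ K (1 : A)
  let Φ : (A ⊗[K] A) ⊗[K] A →ₗ[K] A ⊗[K] A :=
    (TensorProduct.rid K _).toLinearMap ∘ₗ (counit ∘ₗ mulLeft K x).lTensor _
  have h1 := congrArg Φ (h.rTensor_comul_one_b r)
  rw [← r.eq] at h1
  simp [Φ] at h1
  rw [Finset.sum_comm] at h1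
  simp [piR_eq_sum r, h1, ← r.eq, Finset.sum_mul_sum, tmul_sum]

theorem commute_piL_piR (x y : A) :
    Commute (piL K A comul counit x) (piR K A comul counit y) := by
  let r := ℛ K (1 : A)
  let Φ : (A ⊗[K] A) ⊗[K] A →ₗ[K] A :=
    (TensorProduct.lid K _).toLinearMap ∘ₗ (counit ∘ₗ mulRight K x).rTensor _ ∘ₗ
    (TensorProduct.rid K _).toLinearMap ∘ₗ (counit ∘ₗ mulLeft K y).lTensor _
  have h1 := congrArg Φ ((h.rTensor_comul_one_a r).symm.trans (h.rTensor_comul_one_b r))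
  simp [Φ] at h1
  rw [Commute, SemiconjBy, piL_eq_sum r, piR_eq_sum r, Finset.sum_mul_sum, Finset.sum_mul_sum]
  simp only [smul_mul_smul_comm]
  conv_rhs => rw [Finset.sum_comm]
  simpa only [smul_smul, mul_comm] using h1

theorem rTensor_comul_mul (s t : A ⊗[K] A) :
    comul.rTensor A (s * t) = comul.rTensor A s * comul.rTensor A t := by
  induction s with
  | zero => simp
  | add s s' hs hs' => simp [add_mul, hs, hs']
  | tmul a b =>
    induction t with
    | zero => simp
    | add t t' ht ht' => simp [mul_add, ht, ht']
    | tmul c d => simp [h.comul_mul]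

/-- `Σ x₍₁₎ ⊗ Π^L(x₍₂₎) = Σ 1₍₁₎ x ⊗ 1₍₂₎`. -/
theorem lTensor_piL_comul (x : A) :
    (piL K A comul counit).lTensor A (comul x) = comul (1 : A) * (x ⊗ₜ[K] 1) := by
  let r := ℛ K (1 : A)
  let Φ : (A ⊗[K] A) ⊗[K] A →ₗ[K] A ⊗[K] A :=
    ((TensorProduct.rid K A).toLinearMap ∘ₗ counit.lTensor A).rTensor A
  have h1 (t : A ⊗[K] A) : Φ (comul.rTensor A t) = t := by
    induction t with
    | zero => simp
    | add s t hs ht => simp only [map_add, hs, ht]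
    | tmul a b => simp [Φ, -lTensor_counit_comul, h.counit_right]
  have h2 (t : A ⊗[K] A) : Φ ((TensorProduct.assoc K A A A).symm (1 ⊗ₜ comul 1) * (t ⊗ₜ 1)) =
      (piL K A comul counit).lTensor A t := by
    induction t with
    | zero => simp
    | add s t hs ht => simp only [map_add, add_tmul, mul_add, hs, ht]
    | tmul a b =>
      simp [Φ, ← r.eq, piL_eq_sum r, tmul_sum, Finset.sum_mul, smul_tmul']
  rw [← h1 (_ * _), h.rTensor_comul_mul, h.weak_comul_unit_b, mul_assoc, rTensor_tmul,
    Algebra.TensorProduct.tmul_mul_tmul, h.comul_one_mul, one_mul, h2]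

/-- `x Π^L(y) = Σ ε(x₍₁₎ y) x₍₂₎`. -/
theorem mul_piL (x y : A) : x * piL K A comul counit y =
    TensorProduct.lid K A ((counit ∘ₗ mulRight K y).rTensor A (comul x)) := by
  have h1 := h.counit_left (x * piL K A comul counit y)
  rw [h.comul_mul, h.comul_piL', ← mul_assoc, h.comul_mul_one, ← (ℛ K x).eq] at h1
  rw [← h1, ← (ℛ K x).eq]
  simp [Finset.sum_mul, h.counit_mul_piL]

/-- `Π^R(x) y = Σ y₍₁₎ ε(x y₍₂₎)`. -/
theorem piR_mul (x y : A) : piR K A comul counit x * y =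
    TensorProduct.rid K A ((counit ∘ₗ mulLeft K x).lTensor A (comul y)) := by
  have h1 := h.counit_right (piR K A comul counit x * y)
  rw [h.comul_mul, h.comul_piR', mul_assoc, h.comul_one_mul, ← (ℛ K y).eq] at h1
  rw [← h1, ← (ℛ K y).eq]
  simp [Finset.mul_sum, h.counit_piR_mul]

/-- `Σ Π^R(x₍₁₎) ⊗ x₍₂₎ = Σ 1₍₁₎ ⊗ x 1₍₂₎`. -/
theorem rTensor_piR_comul (x : A) :
    (piR K A comul counit).rTensor A (comul x) = (1 ⊗ₜ[K] x) * comul (1 : A) := by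
  let r := ℛ K (1 : A)
  have h1 := h.lTensor_piL_comul 1
  rw [← Algebra.TensorProduct.one_def, mul_one] at h1
  rw [← h1, ← r.eq, ← (ℛ K x).eq]
  simp only [map_sum, lTensor_tmul, rTensor_tmul, Finset.mul_sum,
    Algebra.TensorProduct.tmul_mul_tmul, one_mul, h.mul_piL, piR_eq_sum r]
  rw [← (ℛ K x).eq]
  simp only [map_sum, rTensor_tmul, tmul_sum, sum_tmul, TensorProduct.lid_tmul, tmul_smul,
    smul_tmul', LinearMap.comp_apply, mulRight_apply]
  exact Finset.sum_comm

theorem piL_piL_mul (x y : A) : piL K A comul counit (piL K A comul counit x * y) =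
    piL K A comul counit x * piL K A comul counit y := by
  rw [h.mul_piL, h.comul_piL', piL_eq_sum (ℛ K 1), ← (ℛ K (1 : A)).eq]
  simp [Finset.sum_mul, mul_assoc]

theorem piR_mul_piR (x y : A) : piR K A comul counit (x * piR K A comul counit y) =
    piR K A comul counit x * piR K A comul counit y := by
  rw [h.piR_mul, h.comul_piR', piR_eq_sum (ℛ K 1), ← (ℛ K (1 : A)).eq]
  simp [Finset.mul_sum, mul_assoc]

end WeakBialgebra

section TensorSquare

variable {k C B : Type*} [CommRing k] [Ring C] [Algebra k C] [Coalgebra k C]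
  [Ring B] [Algebra k B]

theorem conv_tmul_apply (f g : C ⊗[k] C →ₗ[k] B) {ι κ : Type*} {x y : C}
    (r : Repr k x ι) (s : Repr k y κ) :
    conv f g (x ⊗ₜ y) = ∑ i ∈ r.index, ∑ j ∈ s.index,
      f (r.left i ⊗ₜ s.left j) * g (r.right i ⊗ₜ s.right j) := by
  simp [conv, ← r.eq, ← s.eq, sum_tmul, tmul_sum]
  exact Finset.sum_comm

end TensorSquare

variable {K A} [Coalgebra K A] {S : A →ₗ[K] A}

/-- The embedding `x ↦ x ⊗ 1`. -/
local notation "ι₁" => AlgHom.toLinearMap (Algebra.TensorProduct.includeLeft : A →ₐ[K] A ⊗[K] A)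

/-- The embedding `x ↦ 1 ⊗ x`. -/
local notation "ι₂" => AlgHom.toLinearMap (Algebra.TensorProduct.includeRight : A →ₐ[K] A ⊗[K] A)

theorem conv_includeLeft_includeRight : conv ι₁ ι₂ = (comul : A →ₗ[K] A ⊗[K] A) := by
  ext x
  rw [conv_apply _ _ (ℛ K x), ← (ℛ K x).eq]
  simp

namespace WeakBialgebra

variable (h : WeakBialgebra K A comul counit)

include h

theorem conv_piL_id : conv (piL K A comul counit) .id = .id := by
  ext x
  have h1 := h.counit_left x
  rw [← h.comul_one_mul, ← (ℛ K x).eq, ← (ℛ K (1 : A)).eq, Finset.sum_mul_sum,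
    Finset.sum_comm] at h1
  rw [conv_apply _ _ (ℛ K x), LinearMap.id_apply]
  simpa [piL_eq_sum (ℛ K (1 : A)), Finset.sum_mul] using h1

theorem conv_id_piR : conv .id (piR K A comul counit) = .id := by
  ext x
  have h1 := h.counit_right x
  rw [← h.comul_mul_one, ← (ℛ K x).eq, ← (ℛ K (1 : A)).eq, Finset.sum_mul_sum] at h1
  rw [conv_apply _ _ (ℛ K x), LinearMap.id_apply]
  simpa [piR_eq_sum (ℛ K (1 : A)), Finset.mul_sum] using h1

theorem conv_includeLeft_includeRight_piL :
    conv ι₁ (ι₂ ∘ₗ piL K A comul counit) = mulLeft K (comul 1) ∘ₗ ι₁ := by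
  ext x
  have h1 := h.lTensor_piL_comul x
  rw [← (ℛ K x).eq] at h1
  rw [conv_apply _ _ (ℛ K x)]
  simpa using h1

theorem conv_includeLeft_piR_includeRight :
    conv (ι₁ ∘ₗ piR K A comul counit) ι₂ = mulRight K (comul 1) ∘ₗ ι₂ := by
  ext x
  have h1 := h.rTensor_piR_comul x
  rw [← (ℛ K x).eq] at h1
  rw [conv_apply _ _ (ℛ K x)]
  simpa using h1

theorem comul_comp_conv (f g : A →ₗ[K] A) :
    comul ∘ₗ conv f g = conv (comul ∘ₗ f) (comul ∘ₗ g) := by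
  ext x
  simp [conv_apply _ _ (ℛ K x), h.comul_mul]

theorem conv_comp_mul' (f g : A →ₗ[K] A) :
    conv f g ∘ₗ mul' K A = conv (f ∘ₗ mul' K A) (g ∘ₗ mul' K A) := by
  refine TensorProduct.ext' fun x y => ?_
  rw [conv_tmul_apply _ _ (ℛ K x) (ℛ K y), conv, LinearMap.comp_apply, LinearMap.comp_apply,
    LinearMap.comp_apply, mul'_apply, h.comul_mul, ← (ℛ K x).eq, ← (ℛ K y).eq]
  simp [Finset.sum_mul_sum]

theorem comul_mul_piL (x y : A) :
    comul (R := K) (x * piL K A comul counit y) =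
      comul x * (piL K A comul counit y ⊗ₜ 1) := by
  rw [h.comul_mul, h.comul_piL', ← mul_assoc, h.comul_mul_one]

theorem comul_piL_mul (x y : A) :
    comul (R := K) (piL K A comul counit x * y) =
      (piL K A comul counit x ⊗ₜ 1) * comul y := by
  rw [h.comul_mul, h.comul_piL, mul_assoc, h.comul_one_mul]

theorem comul_piR_mul (x y : A) :
    comul (R := K) (piR K A comul counit x * y) =
      (1 ⊗ₜ piR K A comul counit x) * comul y := by
  rw [h.comul_mul, h.comul_piR', mul_assoc, h.comul_one_mul]

theorem piL_one : piL K A comul counit 1 = 1 := by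
  conv_rhs => rw [← h.counit_left 1]
  simp [piL, ← Algebra.TensorProduct.one_def, -rTensor_counit_comul]

theorem piR_one : piR K A comul counit 1 = 1 := by
  conv_rhs => rw [← h.counit_right 1]
  simp [piR, ← Algebra.TensorProduct.one_def, -lTensor_counit_comul]

end WeakBialgebra

namespace WeakHopfAlgebra

variable (h : WeakHopfAlgebra K A comul counit S)

include h

theorem conv_id_antipode : conv .id S = piL K A comul counit := by
  ext x
  rw [← h.antipode_a]
  rfl

theorem conv_antipode_id : conv S .id = piR K A comul counit := by
  ext x
  rw [← h.antipode_b]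
  rfl

theorem conv_antipode_piL : conv S (piL K A comul counit) = S := by
  rw [← h.conv_id_antipode]
  ext x
  conv_rhs => rw [← h.antipode_c]
  simp [conv, ← (ℛ K x).eq, lTensor]

theorem conv_piR_antipode : conv (piR K A comul counit) S = S := by
  rw [← h.conv_antipode_id, conv_assoc, h.conv_id_antipode, h.conv_antipode_piL]

/-- The antipode is antimultiplicative. -/
theorem antipode_mul (x y : A) : S (x * y) = S y * S x := by
  let F := mul' K A
  let G := S ∘ₗ mul' K A
  let H := mul' K A ∘ₗ map S S ∘ₗ (TensorProduct.comm K A A).toLinearMap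
  have hB := h.toWeakBialgebra
  have h1 (x y : A) : conv F H (x ⊗ₜ y) =
      conv (mulRight K (piL K A comul counit y)) S x := by
    rw [← h.conv_id_antipode, conv_tmul_apply _ _ (ℛ K x) (ℛ K y), conv_apply _ _ (ℛ K x)]
    simp [F, H, conv_apply _ _ (ℛ K y), Finset.mul_sum, Finset.sum_mul, mul_assoc]
  have hFG : conv F G = piL K A comul counit ∘ₗ mul' K A := by
    rw [← h.conv_id_antipode, hB.conv_comp_mul']
    rfl
  have hGF : conv G F = piR K A comul counit ∘ₗ mul' K A := by
    rw [← h.conv_antipode_id, hB.conv_comp_mul']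
    rfl
  have hFH : conv F H = conv F G := by
    rw [hFG]
    refine TensorProduct.ext' fun x y => ?_
    rw [h1, conv_apply _ _ (ℛ K x), LinearMap.comp_apply, mul'_apply, ← hB.piL_mul_piL,
      ← h.antipode_a (x * _), hB.comul_mul_piL, ← (ℛ K x).eq]
    simp [Finset.sum_mul]
  have hHF : conv H F = conv G F := by
    rw [hGF]
    refine TensorProduct.ext' fun x y => ?_
    rw [LinearMap.comp_apply, mul'_apply, ← hB.piR_piR_mul, ← h.antipode_b (_ * y),
      hB.comul_piR_mul, ← (ℛ K y).eq, ← h.conv_antipode_id, conv_apply _ _ (ℛ K x),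
      conv_tmul_apply _ _ (ℛ K x) (ℛ K y), Finset.sum_comm]
    simp [H, F, Finset.sum_mul, Finset.mul_sum, mul_assoc]
  have hG : G = conv H (conv F H) := by
    rw [hFH, ← conv_assoc, hHF, hGF, ← hB.conv_comp_mul', h.conv_piR_antipode]
  have h2 (z : A) : conv S (conv (mulRight K (piL K A comul counit z)) S) =
      mulLeft K (piL K A comul counit z) ∘ₗ S := by
    have h3 : mulRight K (piL K A comul counit z) ∘ₗ piR K A comul counit =
        mulLeft K (piL K A comul counit z) ∘ₗ piR K A comul counit := by
      ext y
      exact (hB.commute_piL_piR z y).symm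
    rw [← conv_assoc, ← LinearMap.comp_id (mulRight K _), conv_mulRight_comp,
      h.conv_antipode_id, h3, conv_mulLeft_comp, h.conv_piR_antipode]
  have h4 : S (x * y) = conv H (conv F H) (x ⊗ₜ y) := by
    rw [← hG]
    rfl
  rw [h4, conv_tmul_apply _ _ (ℛ K x) (ℛ K y), Finset.sum_comm]
  have h5 (j) : ∑ i ∈ (ℛ K x).index, H ((ℛ K x).left i ⊗ₜ (ℛ K y).left j) *
      conv F H ((ℛ K x).right i ⊗ₜ (ℛ K y).right j) =
      S ((ℛ K y).left j) * piL K A comul counit ((ℛ K y).right j) * S x := by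
    have := LinearMap.congr_fun (h2 ((ℛ K y).right j)) x
    rw [conv_apply _ _ (ℛ K x)] at this
    rw [mul_assoc, ← show _ = piL K A comul counit ((ℛ K y).right j) * S x from this]
    simp [h1, H, Finset.mul_sum, mul_assoc]
  simp_rw [h5]
  rw [← Finset.sum_mul, ← conv_apply, h.conv_antipode_piL]

theorem piR_antipode (x : A) : piR K A comul counit (S x) =
    piR K A comul counit (piL K A comul counit x) := by
  conv_lhs => rw [← h.conv_piR_antipode]
  conv_rhs => rw [← h.conv_id_antipode]
  simp [conv_apply _ _ (ℛ K x), h.toWeakBialgebra.piR_piR_mul]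

theorem piL_antipode (x : A) : piL K A comul counit (S x) =
    piL K A comul counit (piR K A comul counit x) := by
  conv_lhs => rw [← h.conv_antipode_piL]
  conv_rhs => rw [← h.conv_antipode_id]
  simp [conv_apply _ _ (ℛ K x), h.toWeakBialgebra.piL_mul_piL]

theorem antipode_piL (x : A) : S (piL K A comul counit x) = piR K A comul counit (S x) := by
  let r := ℛ K (1 : A)
  have hB := h.toWeakBialgebra
  have h1 := hB.rTensor_piR_comul 1
  rw [← Algebra.TensorProduct.one_def, one_mul] at h1
  have h2 := h.antipode_a 1
  rw [hB.piL_one, ← h1, ← r.eq] at h2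
  rw [h.piR_antipode]
  conv_lhs => rw [← h.conv_piR_antipode]
  rw [conv, LinearMap.comp_apply, LinearMap.comp_apply, hB.comul_piL, ← h1, ← r.eq]
  simp only [map_sum, rTensor_tmul, lTensor_tmul, mul'_apply] at h2
  simp [Finset.mul_sum, hB.piR_mul_piR, mul_assoc]
  rw [← Finset.mul_sum, h2, mul_one]

theorem antipode_piR (x : A) : S (piR K A comul counit x) = piL K A comul counit (S x) := by
  let r := ℛ K (1 : A)
  have hB := h.toWeakBialgebra
  have h1 := hB.lTensor_piL_comul 1
  rw [← Algebra.TensorProduct.one_def, mul_one] at h1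
  have h2 := h.antipode_b 1
  rw [hB.piR_one, ← h1, ← r.eq] at h2
  rw [h.piL_antipode]
  conv_lhs => rw [← h.conv_antipode_piL]
  rw [conv, LinearMap.comp_apply, LinearMap.comp_apply, hB.comul_piR, ← h1, ← r.eq]
  simp only [map_sum, rTensor_tmul, lTensor_tmul, mul'_apply] at h2
  simp [Finset.sum_mul, hB.piL_piL_mul, ← mul_assoc]
  rw [← Finset.sum_mul, h2, one_mul]

end WeakHopfAlgebra

namespace WeakBialgebra

variable (h : WeakBialgebra K A comul counit)

include h

theorem map_piR_piL_comm_comul_one :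
    map (piR K A comul counit) (piL K A comul counit) (TensorProduct.comm K A A (comul 1)) =
      comul (R := K) (1 : A) := by
  let r := ℛ K (1 : A)
  have h1 := h.lTensor_piL_comul 1
  rw [← Algebra.TensorProduct.one_def, mul_one] at h1
  conv_rhs => rw [← h1]
  rw [← r.eq]
  simp only [map_sum, TensorProduct.comm_tmul, TensorProduct.map_tmul, lTensor_tmul,
    piL_eq_sum r, piR_eq_sum r, sum_tmul, tmul_sum, tmul_smul, ← smul_tmul',
    Finset.smul_sum, smul_smul]
  conv_rhs =>
    enter [2, j, 2, k]
    rw [h.counit_mul_a r, Finset.sum_smul]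
  conv_rhs =>
    enter [2, j]
    rw [Finset.sum_comm]
  conv_rhs =>
    rw [Finset.sum_comm]
    enter [2, i]
    rw [Finset.sum_comm]

end WeakBialgebra

/-- The map `x ↦ Σ S(x₍₂₎) ⊗ S(x₍₁₎)`. -/
theorem conv_includeRight_includeLeft_apply (x : A) : conv (ι₂ ∘ₗ S) (ι₁ ∘ₗ S) x =
    map S S (TensorProduct.comm K A A (comul x)) := by
  rw [conv_apply _ _ (ℛ K x), ← (ℛ K x).eq]
  simp

namespace WeakHopfAlgebra

variable (h : WeakHopfAlgebra K A comul counit S)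

include h

theorem map_antipode_comm_comul_one :
    map S S (TensorProduct.comm K A A (comul 1)) = comul (R := K) (1 : A) := by
  have hB := h.toWeakBialgebra
  have h1 := hB.rTensor_piR_comul 1
  rw [← Algebra.TensorProduct.one_def, one_mul] at h1
  have h2 := hB.lTensor_piL_comul 1
  rw [← Algebra.TensorProduct.one_def, mul_one] at h2
  conv_rhs => rw [← hB.map_piR_piL_comm_comul_one, ← h1, ← h2, ← (ℛ K (1 : A)).eq]
  conv_lhs => rw [← h1, ← h2, ← (ℛ K (1 : A)).eq]
  simp [h.antipode_piL, h.antipode_piR, h.piL_antipode, h.piR_antipode]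

theorem comul_one_mul_map_antipode_comm (x : A) :
    comul (R := K) (1 : A) * map S S (TensorProduct.comm K A A (comul x)) =
      map S S (TensorProduct.comm K A A (comul x)) := by
  rw [← h.map_antipode_comm_comul_one]
  conv_rhs => rw [← h.toWeakBialgebra.comul_mul_one]
  rw [← (ℛ K (1 : A)).eq, ← (ℛ K x).eq]
  simp only [map_sum, Finset.sum_mul_sum, Algebra.TensorProduct.tmul_mul_tmul,
    TensorProduct.comm_tmul, TensorProduct.map_tmul, h.antipode_mul]
  exact Finset.sum_comm

/-- The antipode is anticomultiplicative. -/
theorem comul_antipode (x : A) : comul (R := K) (S x) =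
    map S S (TensorProduct.comm K A A (comul x)) := by
  have hB := h.toWeakBialgebra
  let F : A →ₗ[K] A ⊗[K] A := comul
  let G : A →ₗ[K] A ⊗[K] A := comul ∘ₗ S
  let H : A →ₗ[K] A ⊗[K] A := conv (ι₂ ∘ₗ S) (ι₁ ∘ₗ S)
  have hFG : conv F G = comul ∘ₗ piL K A comul counit := by
    rw [← h.conv_id_antipode, hB.comul_comp_conv]
    rfl
  have hGF : conv G F = comul ∘ₗ piR K A comul counit := by
    rw [← h.conv_antipode_id, hB.comul_comp_conv]
    rfl
  have hFH : conv F H = comul ∘ₗ piL K A comul counit := by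
    calc conv F H = conv (conv ι₁ (conv ι₂ (ι₂ ∘ₗ S))) (ι₁ ∘ₗ S) := by
          rw [← conv_assoc ι₁ ι₂, conv_includeLeft_includeRight, conv_assoc]
      _ = mulLeft K (comul 1) ∘ₗ conv ι₁ (ι₁ ∘ₗ S) := by
          rw [← LinearMap.comp_id ι₂, LinearMap.comp_assoc, LinearMap.id_comp,
            ← algHom_comp_conv, h.conv_id_antipode, hB.conv_includeLeft_includeRight_piL,
            conv_mulLeft_comp]
      _ = _ := by
          rw [← LinearMap.comp_id ι₁, LinearMap.comp_assoc, LinearMap.id_comp,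
            ← algHom_comp_conv, h.conv_id_antipode]
          ext x
          simp [hB.comul_piL']
  have hHF : conv H F = comul ∘ₗ piR K A comul counit := by
    calc conv H F = conv (ι₂ ∘ₗ S) (conv (conv (ι₁ ∘ₗ S) ι₁) ι₂) := by
          rw [conv_assoc, conv_assoc, conv_includeLeft_includeRight]
      _ = mulRight K (comul 1) ∘ₗ conv (ι₂ ∘ₗ S) ι₂ := by
          rw [← LinearMap.comp_id ι₁, LinearMap.comp_assoc, LinearMap.id_comp,
            ← algHom_comp_conv, h.conv_antipode_id, hB.conv_includeLeft_piR_includeRight,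
            conv_mulRight_comp]
      _ = _ := by
          rw [← LinearMap.comp_id ι₂, LinearMap.comp_assoc, LinearMap.id_comp,
            ← algHom_comp_conv, h.conv_antipode_id]
          ext x
          simp [hB.comul_piR']
  have hRH : conv (comul ∘ₗ piR K A comul counit) H = mulLeft K (comul 1) ∘ₗ H := by
    have h1 : comul ∘ₗ piR K A comul counit =
        mulLeft K (comul 1) ∘ₗ ι₂ ∘ₗ piR K A comul counit := by
      ext x
      simp [hB.comul_piR]
    rw [h1, conv_mulLeft_comp, ← conv_assoc, ← algHom_comp_conv, h.conv_piR_antipode]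
  have hG : G = conv (conv G F) G := by
    rw [conv_assoc, hFG, ← hB.comul_comp_conv, h.conv_antipode_piL]
  rw [hGF, ← hHF, conv_assoc, hFG, ← hFH, ← conv_assoc, hHF, hRH] at hG
  rw [← h.comul_one_mul_map_antipode_comm, ← conv_includeRight_includeLeft_apply]
  exact LinearMap.congr_fun hG x

end WeakHopfAlgebra

theorem Module.End.exists_pow_mul_mul_pow {k V : Type*} [Field k] [AddCommGroup V]
    [Module k V] [FiniteDimensional k V] (U : Module.End k V) :
    ∃ n ≠ 0, ∃ R ∈ Algebra.adjoin k {U}, U ^ n * R * U ^ n = U ^ n := by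
  obtain ⟨q, hq, hX⟩ := Polynomial.exists_eq_pow_rootMultiplicity_mul_and_not_dvd
    (minpoly k U) (minpoly.ne_zero (Algebra.IsIntegral.isIntegral U)) 0
  rw [Polynomial.C_0, sub_zero] at hq hX
  set m := (minpoly k U).rootMultiplicity 0
  obtain ⟨a, b, hab⟩ : IsCoprime (Polynomial.X ^ (m + 1)) q :=
    ((Polynomial.irreducible_X.coprime_iff_not_dvd).2 hX).pow_left
  refine ⟨m + 1, m.succ_ne_zero, Polynomial.aeval U a,
    Polynomial.aeval_mem_adjoin_singleton k U, ?_⟩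
  have h1 : Polynomial.X ^ (m + 1) * a * Polynomial.X ^ (m + 1) +
      Polynomial.X * b * minpoly k U = Polynomial.X ^ (m + 1) := by
    linear_combination Polynomial.X ^ (m + 1) * hab + Polynomial.X * b * hq
  simpa using congrArg (Polynomial.aeval U) h1

theorem map_mul_apply {M : Type*} [AddCommGroup M] [Module K M] (f g : Module.End K M)
    (t : M ⊗[K] M) : map (f * g) (f * g) t = map f f (map g g t) := by
  rw [Module.End.mul_eq_comp, TensorProduct.map_comp, LinearMap.comp_apply]

section ComulCompatible

variable {P : A →ₗ[K] A}

theorem conv_comp_of_comul (hP : ∀ x, comul (R := K) (P x) = map P P (comul x))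
    (f g : A →ₗ[K] A) : conv f g ∘ₗ P = conv (f ∘ₗ P) (g ∘ₗ P) := by
  ext x
  simp [conv, hP, ← (ℛ K x).eq]

theorem conv_congr_of_comul_eq_map {f g g' k k' : A →ₗ[K] A} {x : A} {t : A ⊗[K] A}
    (ht : comul (R := K) x = map f f t) (hg : g ∘ₗ f = g' ∘ₗ f) (hk : k ∘ₗ f = k' ∘ₗ f) :
    conv g k x = conv g' k' x := by
  simp only [conv, LinearMap.comp_apply, ht]
  rw [← LinearMap.comp_apply (map g k), ← LinearMap.comp_apply (map g' k'),
    ← TensorProduct.map_comp, ← TensorProduct.map_comp, hg, hk]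

theorem comul_pow {U : Module.End K A}
    (hU : ∀ x, comul (R := K) (U x) = map U U (comul x)) (n : ℕ) (x : A) :
    comul (R := K) ((U ^ n) x) = map (U ^ n) (U ^ n) (comul x) := by
  induction n generalizing x with
  | zero => simp [Module.End.one_eq_id]
  | succ n ih => rw [pow_succ, Module.End.mul_apply, ih, hU, map_mul_apply]

theorem comul_mul_of_mul_mul {T R : Module.End K A}
    (hT : ∀ x, comul (R := K) (T x) = map T T (comul x)) (hRT : Commute T R)
    (h : T * R * T = T) (x : A) :
    comul (R := K) ((R * T) x) = map (R * T) (R * T) (comul x) := by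
  have h1 : R * T * T = T := by rw [← hRT.eq, h]
  have h2 : comul (R := K) ((R * T) x) = map (R * T) (R * T) (comul ((R * T) x)) := by
    rw [← hRT.eq, Module.End.mul_apply, hT, hRT.eq, ← map_mul_apply, h1]
  rw [h2, map_mul_apply, ← hT, ← Module.End.mul_apply T, ← mul_assoc, h, hT, ← map_mul_apply]

end ComulCompatible

namespace WeakBialgebra

variable (h : WeakBialgebra K A comul counit)

include h

theorem piL_eq_zero {x : A} (hx : piR K A comul counit (piL K A comul counit x) = 0) :
    piL K A comul counit x = 0 := by
  have h1 := h.rTensor_piR_comul 1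
  rw [← Algebra.TensorProduct.one_def, one_mul] at h1
  have h2 (a : A) :
      counit (R := K) (piR K A comul counit a * piL K A comul counit x) = 0 := by
    rw [← (h.commute_piL_piR x a).eq, ← h.counit_piR_mul, hx, zero_mul, map_zero]
  rw [← h.piL_piL]
  generalize piL K A comul counit x = y at h2 ⊢
  rw [piL, LinearMap.comp_apply, LinearMap.comp_apply, LinearMap.comp_apply, ← h1,
    ← (ℛ K (1 : A)).eq]
  simp [Finset.sum_mul, h2, -rTensor_counit_comul]

theorem piR_eq_zero {x : A} (hx : piL K A comul counit (piR K A comul counit x) = 0) :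
    piR K A comul counit x = 0 := by
  have h1 := h.lTensor_piL_comul 1
  rw [← Algebra.TensorProduct.one_def, mul_one] at h1
  have h2 (a : A) :
      counit (R := K) (piR K A comul counit x * piL K A comul counit a) = 0 := by
    rw [← (h.commute_piL_piR a x).eq, ← h.counit_mul_piL, hx, mul_zero, map_zero]
  rw [← h.piR_piR]
  generalize piR K A comul counit x = y at h2 ⊢
  rw [piR, LinearMap.comp_apply, LinearMap.comp_apply, LinearMap.comp_apply, ← h1,
    ← (ℛ K (1 : A)).eq]
  simp [Finset.mul_sum, h2, -lTensor_counit_comul]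

end WeakBialgebra

namespace WeakHopfAlgebra

variable (h : WeakHopfAlgebra K A comul counit S)

include h

theorem piL_eq_zero {x : A} (hx : S (piL K A comul counit x) = 0) :
    piL K A comul counit x = 0 := by
  rw [h.antipode_piL, h.piR_antipode] at hx
  exact h.toWeakBialgebra.piL_eq_zero hx

theorem piR_eq_zero {x : A} (hx : S (piR K A comul counit x) = 0) :
    piR K A comul counit x = 0 := by
  rw [h.antipode_piR, h.piL_antipode] at hx
  exact h.toWeakBialgebra.piR_eq_zero hx

theorem antipode_antipode_pow_piL_eq_zero (n : ℕ) {x : A}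
    (hx : ((S * S : Module.End K A) ^ n) (piL K A comul counit x) = 0) :
    piL K A comul counit x = 0 := by
  induction n generalizing x with
  | zero => simpa using hx
  | succ n ih =>
    rw [pow_succ, Module.End.mul_apply, Module.End.mul_apply, h.antipode_piL,
      h.antipode_piR] at hx
    have h1 := ih hx
    rw [← h.antipode_piR] at h1
    have h2 := h.piR_eq_zero h1
    rw [← h.antipode_piL] at h2
    exact h.piL_eq_zero h2

theorem comul_antipode_antipode (x : A) : comul (R := K) ((S * S : Module.End K A) x) =
    map (S * S : Module.End K A) (S * S : Module.End K A) (comul x) := by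
  rw [Module.End.mul_apply, h.comul_antipode, h.comul_antipode, map_mul_apply,
    ← (ℛ K x).eq]
  simp

theorem exists_comul_antipode_pow (j : ℕ) (x : A) : ∃ t : A ⊗[K] A,
    comul (R := K) ((S ^ j : Module.End K A) x) =
      map (S ^ j : Module.End K A) (S ^ j : Module.End K A) t := by
  induction j with
  | zero => exact ⟨comul x, by simp [Module.End.one_eq_id]⟩
  | succ j ih =>
    obtain ⟨t, ht⟩ := ih
    refine ⟨TensorProduct.comm K A A t, ?_⟩
    rw [pow_succ', Module.End.mul_apply, h.comul_antipode, ht, map_mul_apply,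
      ← TensorProduct.map_comm]

/-- Let `P` be comultiplicative with `Π^L ∘ P = Π^L` and `Π^R ∘ P = Π^R`, and suppose that each
`Δ(f(x))` lies in the image of `f ⊗ f`. If `S ∘ P ∘ f = S ∘ f`, then `P ∘ f = f`. -/
theorem comp_eq_of_antipode_comp_eq {P f : A →ₗ[K] A}
    (hP : ∀ x, comul (R := K) (P x) = map P P (comul x))
    (hPL : piL K A comul counit ∘ₗ P = piL K A comul counit)
    (hPR : piR K A comul counit ∘ₗ P = piR K A comul counit)
    (hf : ∀ x, ∃ t, comul (R := K) (f x) = map f f t)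
    (hSf : S ∘ₗ P ∘ₗ f = S ∘ₗ f) : P ∘ₗ f = f := by
  have hB := h.toWeakBialgebra
  have h1 : conv .id (S ∘ₗ P) ∘ₗ f = piL K A comul counit ∘ₗ f := by
    ext x
    obtain ⟨t, ht⟩ := hf x
    rw [← h.conv_id_antipode]
    exact conv_congr_of_comul_eq_map ht rfl hSf
  ext x
  obtain ⟨t, ht⟩ := hf x
  symm
  calc f x = conv .id (conv S .id ∘ₗ P) (f x) := by
        rw [h.conv_antipode_id, hPR, hB.conv_id_piR, LinearMap.id_apply]
    _ = conv (conv .id (S ∘ₗ P)) P (f x) := by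
        rw [conv_comp_of_comul hP, LinearMap.id_comp, conv_assoc]
    _ = conv (piL K A comul counit) P (f x) := conv_congr_of_comul_eq_map ht h1 rfl
    _ = conv (piL K A comul counit) .id (P (f x)) := by
        rw [← LinearMap.comp_apply _ P, conv_comp_of_comul hP, hPL, LinearMap.id_comp]
    _ = P (f x) := by rw [hB.conv_piL_id, LinearMap.id_apply]

/-- The antipode of a finite-dimensional weak Hopf algebra is injective. -/
theorem antipode_injective [FiniteDimensional K A] : Function.Injective S := by
  obtain ⟨n, hn, R, hR, hRn⟩ := Module.End.exists_pow_mul_mul_pow (S * S : Module.End K A)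
  set U : Module.End K A := S * S with hU
  have hcomm {V : Module.End K A} (hV : Commute V U) : Commute V R :=
    Algebra.commute_of_mem_adjoin_singleton_of_commute hR hV
  have hSU : Commute (S : Module.End K A) U := (Commute.refl _).mul_right (Commute.refl _)
  have hLU : Commute (piL K A comul counit : Module.End K A) U :=
    LinearMap.ext fun x => by simp [hU, h.antipode_piL, h.antipode_piR]
  set T := U ^ n with hT
  set P := R * T with hPdef
  have hTR : Commute T R := hcomm ((Commute.refl U).pow_left n)
  have hTP : T * P = T := by rw [hPdef, ← mul_assoc, hRn]
  have hPT : P * T = T := by rw [hPdef, ← hTR.eq, hRn]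
  have hcommP {V : Module.End K A} (hV : Commute V U) : Commute V P :=
    (hcomm hV).mul_right (hV.pow_right n)
  have hP := comul_mul_of_mul_mul (comul_pow h.comul_antipode_antipode n) hTR hRn
  have hPL : piL K A comul counit ∘ₗ P = piL K A comul counit := by
    ext x
    rw [← sub_eq_zero, LinearMap.comp_apply, ← map_sub]
    refine h.antipode_antipode_pow_piL_eq_zero n ?_
    have h1 : T (piL K A comul counit (P x - x)) = piL K A comul counit (T (P x - x)) :=
      (LinearMap.congr_fun (hLU.pow_right n).eq (P x - x)).symm
    rw [← hU, ← hT, h1, map_sub, ← Module.End.mul_apply T, hTP, sub_self, map_zero]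
  have hPR : piR K A comul counit ∘ₗ P = piR K A comul counit := by
    ext x
    rw [← sub_eq_zero, LinearMap.comp_apply, ← map_sub]
    refine h.piR_eq_zero ?_
    rw [h.antipode_piR, map_sub, ← Module.End.mul_apply, (hcommP hSU).eq, Module.End.mul_apply,
      map_sub, ← LinearMap.comp_apply, hPL, sub_self]
  have hstep (j : ℕ) (hj : P * (S ^ (j + 1) : Module.End K A) = S ^ (j + 1)) :
      P * (S ^ j : Module.End K A) = S ^ j := by
    refine h.comp_eq_of_antipode_comp_eq hP hPL hPR (h.exists_comul_antipode_pow j) ?_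
    change (S : Module.End K A) * (P * S ^ j) = S * S ^ j
    rw [← mul_assoc, (hcommP hSU).eq, mul_assoc, ← pow_succ', hj]
  have hP1 (j : ℕ) (hj : P * (S ^ j : Module.End K A) = S ^ j) : P = 1 := by
    induction j with
    | zero => simpa using hj
    | succ j ih => exact ih (hstep j hj)
  have hone : P = 1 := hP1 (2 * n) (by rw [pow_mul, pow_two]; exact hPT)
  obtain ⟨m, rfl⟩ := Nat.exists_eq_succ_of_ne_zero hn
  have hleft : (R * U ^ m * S) * S = (1 : Module.End K A) := by
    rw [← hone, hPdef, hT, pow_succ, hU]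
    simp only [mul_assoc]
  exact Function.LeftInverse.injective (g := R * U ^ m * S) (LinearMap.congr_fun hleft)

end WeakHopfAlgebra

namespace WeakBialgebra

variable (h : WeakBialgebra K A comul counit)

include h

theorem leftIntegral_iff_forall_piL_eq_zero (l : A) :
    (∀ x : A, x * l = piL K A comul counit x * l) ↔
      ∀ y : A, piL K A comul counit y = 0 → y * l = 0 := by
  refine ⟨fun hl y hy => by rw [hl, hy, zero_mul], fun hl x => ?_⟩
  rw [← sub_eq_zero, ← sub_mul]
  exact hl _ (by rw [map_sub, h.piL_piL, sub_self])

end WeakBialgebra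

namespace WeakHopfAlgebra

variable (h : WeakHopfAlgebra K A comul counit S)

include h

/-- `Σ S(x₍₁₎) x₍₂₎ l₍₁₎ ⊗ x₍₃₎ l₍₂₎ = Σ l₍₁₎ ⊗ x l₍₂₎`. -/
theorem conv_includeLeft_antipode_comul_mul (l : A) :
    conv (ι₁ ∘ₗ S) (comul ∘ₗ mulRight K l) = mulRight K (comul l) ∘ₗ ι₂ := by
  have hB := h.toWeakBialgebra
  have h1 : comul ∘ₗ mulRight K l = mulRight K (comul l) ∘ₗ (comul : A →ₗ[K] A ⊗[K] A) := by
    ext x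
    simp [hB.comul_mul]
  have h2 : conv (ι₁ ∘ₗ S) comul = mulRight K (comul 1) ∘ₗ ι₂ := by
    rw [← hB.conv_includeLeft_piR_includeRight, ← h.conv_antipode_id, algHom_comp_conv,
      LinearMap.comp_id, conv_assoc, conv_includeLeft_includeRight]
  rw [h1, conv_mulRight_comp, h2]
  ext x
  simp [mul_assoc, hB.comul_one_mul]

theorem tmul_mul_comul_eq_of_leftIntegral {l : A}
    (hl : ∀ x : A, x * l = piL K A comul counit x * l) (x : A) :
    (1 ⊗ₜ[K] x) * comul l = (S x ⊗ₜ[K] 1) * comul l := by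
  have h1 : comul ∘ₗ mulRight K l =
      mulRight K (comul l) ∘ₗ ι₁ ∘ₗ piL K A comul counit := by
    ext x
    simp [hl x, h.toWeakBialgebra.comul_piL_mul]
  have h2 := h.conv_includeLeft_antipode_comul_mul l
  rw [h1, conv_mulRight_comp, ← algHom_comp_conv, h.conv_antipode_piL] at h2
  exact (LinearMap.congr_fun h2 x).symm

theorem mul_eq_zero_of_tmul_mul_comul_eq {l y : A} (hy : piL K A comul counit y = 0)
    (hl : (1 ⊗ₜ[K] y) * comul l = (S y ⊗ₜ[K] 1) * comul l) : y * l = 0 := by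
  have hB := h.toWeakBialgebra
  have h1 (z : A) : counit (R := K) (S y * z) = 0 := by
    rw [← hB.counit_piR_mul, h.piR_antipode, hy, map_zero, zero_mul, map_zero]
  have h2 := congrArg (TensorProduct.lid K A ∘ counit.rTensor A) hl
  have h3 := hB.counit_left l
  rw [← (ℛ K l).eq] at h2 h3
  rw [← h3]
  simp only [map_sum, rTensor_tmul, TensorProduct.lid_tmul, Finset.mul_sum, mul_smul_comm]
  simpa [Finset.mul_sum, h1] using h2

theorem leftIntegral_iff_rightIntegral_antipode [FiniteDimensional K A] (l : A) :
    (∀ x : A, x * l = piL K A comul counit x * l) ↔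
      ∀ x : A, S l * x = S l * piR K A comul counit x := by
  have hS := h.antipode_injective
  refine ⟨fun hl x => ?_, fun hl x => hS ?_⟩
  · obtain ⟨y, rfl⟩ := LinearMap.injective_iff_surjective.1 hS x
    rw [← h.antipode_mul, ← h.antipode_piL, ← h.antipode_mul, hl]
  · rw [h.antipode_mul, hl, h.antipode_mul, h.antipode_piL]

theorem leftIntegral_iff_lTensor_comul (l : A) :
    (∀ x : A, x * l = piL K A comul counit x * l) ↔
      ∀ x : A, lTensor A (mulLeft K x) (comul l) = rTensor A (mulLeft K (S x)) (comul l) := by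
  have h1 (x : A) : lTensor A (mulLeft K x) (comul l) = (1 ⊗ₜ[K] x) * comul l := by
    rw [← (ℛ K l).eq]
    simp [Finset.mul_sum]
  have h2 (x : A) : rTensor A (mulLeft K x) (comul l) = (x ⊗ₜ[K] 1) * comul l := by
    rw [← (ℛ K l).eq]
    simp [Finset.mul_sum]
  simp only [h1, h2]
  exact ⟨h.tmul_mul_comul_eq_of_leftIntegral,
    fun hl => (h.toWeakBialgebra.leftIntegral_iff_forall_piL_eq_zero l).2
      fun y hy => h.mul_eq_zero_of_tmul_mul_comul_eq hy (hl y)⟩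

end WeakHopfAlgebra

end

/-- For an element `l` of a weak Hopf algebra `A`, the following are
equivalent: (a) `l` is a left integral; (b) `Σ l₍₁₎ ⊗ x l₍₂₎ = Σ S(x) l₍₁₎ ⊗ l₍₂₎` for
all `x`; (c) `y l = 0` for all `y ∈ ker Π^L`; (d) `S(l)` is a right integral. -/
theorem weakHopfAlgebra_leftIntegral_tfae
    (K : Type*) [Field K] (A : Type*) [Ring A] [Algebra K A] [FiniteDimensional K A]
    (Δ : A →ₗ[K] A ⊗[K] A) (ε : A →ₗ[K] K) (S : A →ₗ[K] A)
    (hA : WeakHopfAlgebra K A Δ ε S) (l : A) :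
    ((∀ x : A, x * l = piL K A Δ ε x * l) ↔
      (∀ x : A, LinearMap.lTensor A (LinearMap.mulLeft K x) (Δ l) =
        LinearMap.rTensor A (LinearMap.mulLeft K (S x)) (Δ l))) ∧
    ((∀ x : A, x * l = piL K A Δ ε x * l) ↔
      (∀ y : A, piL K A Δ ε y = 0 → y * l = 0)) ∧
    ((∀ x : A, x * l = piL K A Δ ε x * l) ↔
      (∀ x : A, S l * x = S l * piR K A Δ ε x)) := by
  let _ : Coalgebra K A :=
    { comul := Δ
      counit := ε
      coassoc := LinearMap.ext hA.toWeakBialgebra.coassoc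
      rTensor_counit_comp_comul := LinearMap.ext fun x =>
        (TensorProduct.lid K A).injective (by simp [hA.toWeakBialgebra.counit_left])
      lTensor_counit_comp_comul := LinearMap.ext fun x =>
        (TensorProduct.rid K A).injective (by simp [hA.toWeakBialgebra.counit_right]) }
  exact ⟨WeakHopfAlgebra.leftIntegral_iff_lTensor_comul hA l,
    WeakBialgebra.leftIntegral_iff_forall_piL_eq_zero hA.toWeakBialgebra l,
    WeakHopfAlgebra.leftIntegral_iff_rightIntegral_antipode hA l⟩
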